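/- arXiv:2602.01462 — 8 statements merged into one kernel-verified Lean document; each statement's English description precedes it below -/
import Mathlib

section
/- Let F be a family of subsets of a finite ground set V and let Ê be any set of edges on V. If F satisfies symmetry, then the subfamily F_Ê (the members of F not covered by Ê) satisfies symmetry; if F is pliable, then F_Ê is pliable; and if F satisfies structural submodularity, then so does F_Ê. -/
/-- Two subsets `A, B` of the ground set `V` cross if all four sets
`A ∩ B`, `A \ B`, `B \ A`, `V \ (A ∪ B)` are nonempty. -/
def Crosses {V : Type*} (A B : Set V) : Prop :=
  (A ∩ B).Nonempty ∧ (A \ B).Nonempty ∧ (B \ A).Nonempty ∧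
    (Set.univ \ (A ∪ B)).Nonempty

/-- At least two of the four propositions hold. -/
def AtLeastTwo (p q r s : Prop) : Prop :=
  (p ∧ q) ∨ (p ∧ r) ∨ (p ∧ s) ∨ (q ∧ r) ∨ (q ∧ s) ∨ (r ∧ s)

/-- A family `F` of subsets of `V` (with `∅ ∉ F` and `V ∉ F`) is pliable if for
every pair `A, B ∈ F`, at least two of `A ∩ B`, `A ∪ B`, `A \ B`, `B \ A` are in `F`. -/
def Pliable {V : Type*} (F : Set (Set V)) : Prop :=
  ∅ ∉ F ∧ Set.univ ∉ F ∧
    ∀ A ∈ F, ∀ B ∈ F, AtLeastTwo (A ∩ B ∈ F) (A ∪ B ∈ F) (A \ B ∈ F) (B \ A ∈ F)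

/-- `F` satisfies symmetry: `S ∈ F` iff `V \ S ∈ F`. -/
def SymmFamily {V : Type*} (F : Set (Set V)) : Prop :=
  ∀ S : Set V, S ∈ F ↔ (Set.univ \ S) ∈ F

/-- `F` satisfies structural submodularity: for every crossing pair `A, B ∈ F`,
at least one of `A ∩ B`, `A ∪ B` is in `F` and at least one of `A \ B`, `B \ A` is in `F`. -/
def StructSubmodular {V : Type*} (F : Set (Set V)) : Prop :=
  ∀ A ∈ F, ∀ B ∈ F, Crosses A B →
    ((A ∩ B ∈ F ∨ A ∪ B ∈ F) ∧ (A \ B ∈ F ∨ B \ A ∈ F))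

/-- `δ_J(S)`: the edges (unordered pairs) of `J` with exactly one endpoint in `S`. -/
def cutLinks {V : Type*} (J : Set (Sym2 V)) (S : Set V) : Set (Sym2 V) :=
  {e ∈ J | ∃ x y, e = s(x, y) ∧ x ∈ S ∧ y ∉ S}

/-- `F_Ê`: the members of `F` not covered by the edge set `Ê`. -/
def uncovered {V : Type*} (F : Set (Set V)) (E : Set (Sym2 V)) : Set (Set V) :=
  {S ∈ F | cutLinks E S = ∅}

/-- `C` is an inclusion-minimal member of `F`: `C ∈ F` and no proper subset of `C` is in `F`. -/
def MinimalIn {V : Type*} (F : Set (Set V)) (C : Set V) : Prop :=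
  C ∈ F ∧ ∀ S : Set V, S ⊂ C → S ∉ F

/-- `C_Ê`: the family of inclusion-minimal members of `F_Ê`. -/
def cores {V : Type*} (F : Set (Set V)) (E : Set (Sym2 V)) : Set (Set V) :=
  {C | MinimalIn (uncovered F E) C}


theorem cutLinks_eq_empty_iff {V : Type*} {E : Set (Sym2 V)} {S : Set V} :
    cutLinks E S = ∅ ↔ ∀ x y, s(x, y) ∈ E → (x ∈ S ↔ y ∈ S) := by
  rw [Set.eq_empty_iff_forall_notMem]
  constructor
  · intro h x y hxy
    constructor
    · intro hx
      by_contra hy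
      exact h s(x, y) ⟨hxy, x, y, rfl, hx, hy⟩
    · intro hy
      by_contra hx
      exact h s(x, y) ⟨hxy, y, x, Sym2.eq_swap, hy, hx⟩
  · rintro h _ ⟨he, x, y, rfl, hx, hy⟩
    exact hy ((h x y he).1 hx)

theorem mem_uncovered {V : Type*} {F : Set (Set V)} {E : Set (Sym2 V)} {S : Set V} :
    S ∈ uncovered F E ↔ S ∈ F ∧ ∀ x y, s(x, y) ∈ E → (x ∈ S ↔ y ∈ S) :=
  and_congr_right fun _ => cutLinks_eq_empty_iff

section
variable {V : Type*} {F : Set (Set V)} {E : Set (Sym2 V)} {A B : Set V}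

theorem inter_mem_uncovered_iff (hA : A ∈ uncovered F E) (hB : B ∈ uncovered F E) :
    A ∩ B ∈ uncovered F E ↔ A ∩ B ∈ F := by
  rw [mem_uncovered] at *
  exact and_iff_left fun x y h => and_congr (hA.2 x y h) (hB.2 x y h)

theorem union_mem_uncovered_iff (hA : A ∈ uncovered F E) (hB : B ∈ uncovered F E) :
    A ∪ B ∈ uncovered F E ↔ A ∪ B ∈ F := by
  rw [mem_uncovered] at *
  exact and_iff_left fun x y h => or_congr (hA.2 x y h) (hB.2 x y h)

theorem diff_mem_uncovered_iff (hA : A ∈ uncovered F E) (hB : B ∈ uncovered F E) :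
    A \ B ∈ uncovered F E ↔ A \ B ∈ F := by
  rw [mem_uncovered] at *
  exact and_iff_left fun x y h => and_congr (hA.2 x y h) (not_congr (hB.2 x y h))

end

/-- restricting to the uncovered subfamily preserves symmetry,
pliability and structural submodularity. -/
theorem stmt0 {V : Type*} [Fintype V] (F : Set (Set V)) (E : Set (Sym2 V)) :
    (SymmFamily F → SymmFamily (uncovered F E)) ∧
    (Pliable F → Pliable (uncovered F E)) ∧
    (StructSubmodular F → StructSubmodular (uncovered F E)) := by
  refine ⟨fun h S => ?_, fun h => ⟨fun h' => h.1 h'.1, fun h' => h.2.1 h'.1, ?_⟩, ?_⟩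
  · simp only [mem_uncovered, ← h S, Set.mem_sdiff, Set.mem_univ, true_and, not_iff_not]
  · intro A hA B hB
    rw [inter_mem_uncovered_iff hA hB, union_mem_uncovered_iff hA hB,
      diff_mem_uncovered_iff hA hB, diff_mem_uncovered_iff hB hA]
    exact h.2.2 A hA.1 B hB.1
  · intro h A hA B hB hAB
    rw [inter_mem_uncovered_iff hA hB, union_mem_uncovered_iff hA hB,
      diff_mem_uncovered_iff hA hB, diff_mem_uncovered_iff hB hA]
    exact h A hA.1 B hB.1 hAB
end

section
/- Let F be a pliable family of subsets of a finite ground set V that satisfies symmetry and structural submodularity. Then the inclusion-minimal sets of F are pairwise disjoint. -/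
/-- the inclusion-minimal sets of a pliable, symmetric,
structurally submodular family are pairwise disjoint. -/
theorem stmt1 {V : Type*} [Fintype V] (F : Set (Set V))
    (hPl : Pliable F) (hSym : SymmFamily F) (hSub : StructSubmodular F) :
    ∀ C₁ C₂ : Set V, MinimalIn F C₁ → MinimalIn F C₂ → C₁ ≠ C₂ →
      Disjoint C₁ C₂ := by
  intro A B hA hB hne
  rw [Set.disjoint_iff_inter_eq_empty]
  by_contra h
  obtain ⟨x, hxA, hxB⟩ := Set.nonempty_iff_ne_empty.mpr h
  have hAB : ¬ A ⊆ B := fun hs => hB.2 A (hs.ssubset_of_ne hne) hA.1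
  have hInter : A ∩ B ∉ F := hA.2 _ (Set.inter_ssubset_left_iff.mpr hAB)
  have hDiffA : A \ B ∉ F :=
    hA.2 _ ⟨Set.sdiff_subset, fun hs => (hs hxA).2 hxB⟩
  have hDiffB : B \ A ∉ F :=
    hB.2 _ ⟨Set.sdiff_subset, fun hs => (hs hxB).2 hxA⟩
  have hTwo := hPl.2.2 A hA.1 B hB.1
  unfold AtLeastTwo at hTwo
  tauto
end

section
/- Let F be a pliable family of subsets of a finite ground set V that satisfies symmetry and structural submodularity. Then F satisfies the sparse crossing property: for any set S∈F, the number of inclusion-minimal sets of F that cross S is zero or one. -/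
/-- A minimal member of a pliable family crossing `S ∈ F` can be removed from `S`. -/
theorem MinimalIn.diff_mem_of_crosses {V : Type*} {F : Set (Set V)} (hPl : Pliable F)
    {C S : Set V} (hC : MinimalIn F C) (hS : S ∈ F) (hCS : Crosses C S) : S \ C ∈ F := by
  obtain ⟨⟨x, hxC, hxS⟩, ⟨y, hyC, hyS⟩, -, -⟩ := hCS
  have hInter : C ∩ S ∉ F :=
    hC.2 _ ⟨Set.inter_subset_left, fun h => hyS (h hyC).2⟩
  have hDiff : C \ S ∉ F :=
    hC.2 _ ⟨Set.sdiff_subset, fun h => (h hxC).2 hxS⟩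
  have h := hPl.2.2 C hC.1 S hS
  unfold AtLeastTwo at h
  tauto

/-- Distinct minimal members of a pliable family are disjoint. -/
theorem MinimalIn.disjoint {V : Type*} {F : Set (Set V)} (hPl : Pliable F)
    {C D : Set V} (hC : MinimalIn F C) (hD : MinimalIn F D) (hne : C ≠ D) :
    Disjoint C D := by
  by_contra hdis
  obtain ⟨x, hxC, hxD⟩ := Set.not_disjoint_iff.1 hdis
  have hInter : C ∩ D ∉ F := by
    refine hC.2 _ ⟨Set.inter_subset_left, fun h => ?_⟩
    have hCD : C ⊆ D := fun z hz => (h hz).2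
    exact hD.2 C (hCD.ssubset_of_ne hne) hC.1
  have hCD : C \ D ∉ F :=
    hC.2 _ ⟨Set.sdiff_subset, fun h => (h hxC).2 hxD⟩
  have hDC : D \ C ∉ F :=
    hD.2 _ ⟨Set.sdiff_subset, fun h => (h hxD).2 hxC⟩
  have h := hPl.2.2 C hC.1 D hD.1
  unfold AtLeastTwo at h
  tauto

/-- sparse crossing property: each `S ∈ F` crosses at most one
inclusion-minimal member of `F`. -/
theorem stmt2 {V : Type*} [Fintype V] (F : Set (Set V))
    (hPl : Pliable F) (hSym : SymmFamily F) (hSub : StructSubmodular F) :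
    ∀ S ∈ F, {C : Set V | MinimalIn F C ∧ Crosses C S}.ncard ≤ 1 := by
  intro S hS
  rw [Set.ncard_le_one (Set.toFinite _)]
  rintro C ⟨hC, hCS⟩ D ⟨hD, hDS⟩
  by_contra hne
  have hdis := Set.disjoint_left.1 (hC.disjoint hPl hD hne)
  have hSC := hC.diff_mem_of_crosses hPl hS hCS
  have hSD := hD.diff_mem_of_crosses hPl hS hDS
  obtain ⟨⟨x, hxC, hxS⟩, ⟨y, hyC, hyS⟩, -, -⟩ := hCS
  obtain ⟨⟨z, hzD, hzS⟩, ⟨w, hwD, hwS⟩, -, -⟩ := hDS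
  have hInterC : S ∩ C ∉ F :=
    hC.2 _ ⟨Set.inter_subset_right, fun h => hyS (h hyC).1⟩
  have hInterD : S ∩ D ∉ F :=
    hD.2 _ ⟨Set.inter_subset_right, fun h => hwS (h hwD).1⟩
  by_cases hcov : ∃ v ∈ S, v ∉ C ∧ v ∉ D
  · obtain ⟨v, hvS, hvC, hvD⟩ := hcov
    have hCross : Crosses (S \ C) (S \ D) :=
      ⟨⟨v, ⟨hvS, hvC⟩, ⟨hvS, hvD⟩⟩,
        ⟨z, ⟨hzS, fun h => hdis h hzD⟩, fun h => h.2 hzD⟩,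
        ⟨x, ⟨hxS, hdis hxC⟩, fun h => h.2 hxC⟩,
        ⟨y, Set.mem_univ y, fun h => h.elim (fun h => hyS h.1) (fun h => hyS h.1)⟩⟩
    have hD' : (S \ C) \ (S \ D) = S ∩ D := by
      ext u
      have := @hdis u
      simp only [Set.mem_sdiff, Set.mem_inter_iff]
      tauto
    have hC' : (S \ D) \ (S \ C) = S ∩ C := by
      ext u
      have := @hdis u
      simp only [Set.mem_sdiff, Set.mem_inter_iff]
      tauto
    have h := (hSub _ hSC _ hSD hCross).2
    rw [hD', hC'] at h
    exact h.elim hInterD hInterC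
  · push Not at hcov
    have hEq : S \ C = S ∩ D := by
      ext u
      have := @hdis u
      have := hcov u
      simp only [Set.mem_sdiff, Set.mem_inter_iff]
      tauto
    exact hInterD (hEq ▸ hSC)
end

section
/- Let F be a pliable family of subsets of a finite ground set V that satisfies symmetry and structural submodularity. If S∈F crosses an inclusion-minimal set C∈F, then both S∪C and S\C belong to F. -/
/-- if `S ∈ F` crosses an inclusion-minimal `C ∈ F`, then both
`S ∪ C` and `S \ C` are in `F`. -/
theorem stmt3 {V : Type*} [Fintype V] (F : Set (Set V))
    (hPl : Pliable F) (hSym : SymmFamily F) (hSub : StructSubmodular F) :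
    ∀ S ∈ F, ∀ C : Set V, MinimalIn F C → Crosses S C →
      S ∪ C ∈ F ∧ S \ C ∈ F := by
  rintro S hS C ⟨hC, hmin⟩ hcross
  obtain ⟨hunion, hdiff⟩ := hSub S hS C hC hcross
  obtain ⟨⟨x, hxS, hxC⟩, -, ⟨y, hyC, hyS⟩, -⟩ := hcross
  have hinter_notMem : S ∩ C ∉ F :=
    hmin _ ⟨Set.inter_subset_right, fun h => hyS (h hyC).1⟩
  have hdiff_notMem : C \ S ∉ F :=
    hmin _ ⟨Set.sdiff_subset, fun h => (h hxC).2 hxS⟩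
  exact ⟨hunion.resolve_left hinter_notMem, hdiff.resolve_right hdiff_notMem⟩
end

section
/- Let G=(V,E,u) be a finite capacitated undirected graph with nonnegative edge capacities and let λ∈ℝ. Then the family of non-trivial small cuts {S : ∅≠S⊊V, u(δ_E(S))<λ} is a pliable family of subsets of V that satisfies symmetry and structural submodularity. -/
open Classical in
/-- `u(δ_E(S))`: total capacity of the edges of `E` with exactly one endpoint in `S`. -/
noncomputable def cutCap {V : Type*} (E : Finset (Sym2 V)) (u : Sym2 V → ℝ) (S : Set V) : ℝ :=
  ∑ e ∈ E, if ∃ x y, e = s(x, y) ∧ x ∈ S ∧ y ∉ S then u e else 0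

theorem cutCap_compl {V : Type*} (E : Finset (Sym2 V)) (u : Sym2 V → ℝ) (S : Set V) :
    cutCap E u Sᶜ = cutCap E u S := by
  classical
  unfold cutCap
  refine Finset.sum_congr rfl fun e _ => if_congr ?_ rfl rfl
  constructor <;> rintro ⟨x, y, rfl, hx, hy⟩ <;> exact ⟨y, x, Sym2.eq_swap, by simp_all⟩

theorem exists_mk_eq_mem_notMem_iff {V : Type*} (a b : V) (S : Set V) :
    (∃ x y, s(a, b) = s(x, y) ∧ x ∈ S ∧ y ∉ S) ↔ (a ∈ S ∧ b ∉ S) ∨ (b ∈ S ∧ a ∉ S) := by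
  constructor
  · rintro ⟨x, y, h, hx, hy⟩
    rcases Sym2.eq_iff.mp h with ⟨rfl, rfl⟩ | ⟨rfl, rfl⟩
    · exact Or.inl ⟨hx, hy⟩
    · exact Or.inr ⟨hx, hy⟩
  · rintro (⟨hx, hy⟩ | ⟨hx, hy⟩)
    · exact ⟨a, b, rfl, hx, hy⟩
    · exact ⟨b, a, Sym2.eq_swap, hx, hy⟩

theorem cutCap_inter_add_cutCap_union_le {V : Type*} (E : Finset (Sym2 V)) (u : Sym2 V → ℝ)
    (hu : ∀ e, 0 ≤ u e) (A B : Set V) :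
    cutCap E u (A ∩ B) + cutCap E u (A ∪ B) ≤ cutCap E u A + cutCap E u B := by
  classical
  unfold cutCap
  rw [← Finset.sum_add_distrib, ← Finset.sum_add_distrib]
  refine Finset.sum_le_sum fun e _ => ?_
  have he := hu e
  induction e using Sym2.ind with
  | _ a b =>
    simp only [exists_mk_eq_mem_notMem_iff]
    simp only [Set.mem_inter_iff, Set.mem_union]
    by_cases ha : a ∈ A <;> by_cases hb : b ∈ A <;> by_cases ha' : a ∈ B <;>
      by_cases hb' : b ∈ B <;> simp [ha, hb, ha', hb', he]

theorem cutCap_sdiff_add_cutCap_sdiff_le {V : Type*} (E : Finset (Sym2 V)) (u : Sym2 V → ℝ)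
    (hu : ∀ e, 0 ≤ u e) (A B : Set V) :
    cutCap E u (A \ B) + cutCap E u (B \ A) ≤ cutCap E u A + cutCap E u B := by
  have h := cutCap_inter_add_cutCap_union_le E u hu A Bᶜ
  rwa [cutCap_compl, ← cutCap_compl E u (A ∪ Bᶜ), Set.compl_union, compl_compl,
    Set.inter_comm Aᶜ, ← Set.sdiff_eq, ← Set.sdiff_eq] at h

/-- A symmetric structurally submodular family avoiding `∅` and `univ` is pliable. -/
theorem StructSubmodular.pliable {V : Type*} {F : Set (Set V)} (hF : StructSubmodular F)
    (hsymm : SymmFamily F) (hempty : ∅ ∉ F) (huniv : Set.univ ∉ F) : Pliable F := by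
  refine ⟨hempty, huniv, fun A hA B hB => ?_⟩
  unfold AtLeastTwo
  by_cases h₁ : (A ∩ B).Nonempty
  swap
  · have hd : Disjoint A B := Set.disjoint_iff_inter_eq_empty.mpr
      (Set.not_nonempty_iff_eq_empty.mp h₁)
    rw [hd.sdiff_eq_left, hd.sdiff_eq_right]
    tauto
  by_cases h₂ : (A \ B).Nonempty
  swap
  · have hs : A ⊆ B := Set.sdiff_eq_empty.mp (Set.not_nonempty_iff_eq_empty.mp h₂)
    rw [Set.inter_eq_left.mpr hs, Set.union_eq_right.mpr hs]
    tauto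
  by_cases h₃ : (B \ A).Nonempty
  swap
  · have hs : B ⊆ A := Set.sdiff_eq_empty.mp (Set.not_nonempty_iff_eq_empty.mp h₃)
    rw [Set.inter_eq_right.mpr hs, Set.union_eq_left.mpr hs]
    tauto
  by_cases h₄ : (Set.univ \ (A ∪ B)).Nonempty
  · have := hF A hA B hB ⟨h₁, h₂, h₃, h₄⟩
    tauto
  · have hc : ∀ x, x ∈ A ∨ x ∈ B := fun x => by
      by_contra hx
      exact h₄ ⟨x, trivial, hx⟩
    have hAB : A \ B = Set.univ \ B := by
      ext x
      have := hc x
      simp only [Set.mem_sdiff, Set.mem_univ]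
      tauto
    have hBA : B \ A = Set.univ \ A := by
      ext x
      have := hc x
      simp only [Set.mem_sdiff, Set.mem_univ]
      tauto
    rw [hAB, hBA]
    have := (hsymm A).mp hA
    have := (hsymm B).mp hB
    tauto

/-- the family of non-trivial small cuts of a capacitated graph is
pliable and satisfies symmetry and structural submodularity. -/
theorem stmt6 {V : Type*} [Fintype V] (E : Finset (Sym2 V)) (u : Sym2 V → ℝ)
    (hu : ∀ e, 0 ≤ u e) (lam : ℝ) :
    Pliable {S : Set V | S.Nonempty ∧ S ≠ Set.univ ∧ cutCap E u S < lam} ∧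
    SymmFamily {S : Set V | S.Nonempty ∧ S ≠ Set.univ ∧ cutCap E u S < lam} ∧
    StructSubmodular {S : Set V | S.Nonempty ∧ S ≠ Set.univ ∧ cutCap E u S < lam} := by
  have hsymm : SymmFamily {S : Set V | S.Nonempty ∧ S ≠ Set.univ ∧ cutCap E u S < lam} := by
    intro S
    simp only [Set.mem_ofPred_eq, ← Set.compl_eq_univ_sdiff, cutCap_compl, Set.nonempty_compl,
      ne_eq, Set.compl_univ_iff, ← Set.nonempty_iff_ne_empty]
    tauto
  have hsub :
      StructSubmodular {S : Set V | S.Nonempty ∧ S ≠ Set.univ ∧ cutCap E u S < lam} := by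
    rintro A ⟨-, hA, hA'⟩ B ⟨-, hB, hB'⟩ ⟨h₁, h₂, h₃, x, -, hx⟩
    have hinter : A ∩ B ≠ Set.univ := fun h => hx (Or.inl (h ▸ Set.mem_univ x : x ∈ A ∩ B).1)
    have hunion : A ∪ B ≠ Set.univ := fun h => hx (h ▸ Set.mem_univ x)
    have hAB : A \ B ≠ Set.univ := fun h => hx (Or.inl (h ▸ Set.mem_univ x : x ∈ A \ B).1)
    have hBA : B \ A ≠ Set.univ := fun h => hx (Or.inr (h ▸ Set.mem_univ x : x ∈ B \ A).1)
    have hle := cutCap_inter_add_cutCap_union_le E u hu A B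
    have hle' := cutCap_sdiff_add_cutCap_sdiff_le E u hu A B
    constructor
    · rcases lt_or_ge (cutCap E u (A ∩ B)) lam with h | h
      · exact Or.inl ⟨h₁, hinter, h⟩
      · exact Or.inr ⟨h₁.mono (Set.inter_subset_left.trans Set.subset_union_left), hunion,
          by linarith⟩
    · rcases lt_or_ge (cutCap E u (A \ B)) lam with h | h
      · exact Or.inl ⟨h₂, hAB, h⟩
      · exact Or.inr ⟨h₃, hBA, by linarith⟩
  exact ⟨hsub.pliable hsymm (fun h => Set.not_nonempty_empty h.1) (fun h => h.2.1 rfl),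
    hsymm, hsub⟩
end

section
/- Let F be a pliable family of subsets of a finite ground set V that satisfies symmetry and structural submodularity. Then F satisfies property (γ*): for any set Ê of edges and sets S0,S1,…,Sk∈F_Ê (k≥1), where S1,…,Sk are pairwise disjoint proper subsets of S0, if an inclusion-minimal set C∈C_Ê crosses all of S0,S1,…,Sk, then the set S0\(S1∪⋯∪Sk∪C) is either empty or belongs to F_Ê. -/
/-- Property (γ). -/
def PropGamma {V : Type*} (F : Set (Set V)) : Prop :=
  ∀ (E : Set (Sym2 V)) (S₀ S₁ C : Set V),
    S₀ ∈ uncovered F E → S₁ ∈ uncovered F E → S₁ ⊂ S₀ →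
    C ∈ cores F E → Crosses C S₀ → Crosses C S₁ →
    S₀ \ (C ∪ S₁) = ∅ ∨ S₀ \ (C ∪ S₁) ∈ uncovered F E

/-- Property (γ*). -/
def PropGammaStar {V : Type*} (F : Set (Set V)) : Prop :=
  ∀ (E : Set (Sym2 V)) (k : ℕ), 1 ≤ k →
    ∀ (S₀ : Set V) (S : Fin k → Set V) (C : Set V),
      S₀ ∈ uncovered F E → (∀ i, S i ∈ uncovered F E) →
      (∀ i, S i ⊂ S₀) → (∀ i j, i ≠ j → Disjoint (S i) (S j)) →
      C ∈ cores F E → Crosses C S₀ → (∀ i, Crosses C (S i)) →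
      S₀ \ ((⋃ i, S i) ∪ C) = ∅ ∨ S₀ \ ((⋃ i, S i) ∪ C) ∈ uncovered F E

/-- Structural submodularity passes to the members not covered by an edge set. -/
theorem StructSubmodular.uncovered {V : Type*} {F : Set (Set V)} (hF : StructSubmodular F)
    (E : Set (Sym2 V)) : StructSubmodular (uncovered F E) := by
  rintro A ⟨hA, hA'⟩ B ⟨hB, hB'⟩ hAB
  obtain ⟨h₁, h₂⟩ := hF A hA B hB hAB
  rw [cutLinks_eq_empty_iff] at hA' hB'
  refine ⟨h₁.imp (⟨·, ?_⟩) (⟨·, ?_⟩), h₂.imp (⟨·, ?_⟩) (⟨·, ?_⟩)⟩ <;>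
    refine cutLinks_eq_empty_iff.mpr fun x y hxy => ?_ <;>
    simp [hA' x y hxy, hB' x y hxy]

/-- Adding to a minimal member disjoint members that it crosses yields a member, as long as
the result stays inside a set other than the ground set. -/
theorem MinimalIn.biUnion_union_mem {V ι : Type*} {F : Set (Set V)} {C U : Set V}
    (hC : MinimalIn F C) (hF : StructSubmodular F) {S : ι → Set V} (hS : ∀ i, S i ∈ F)
    (hdisj : ∀ i j, i ≠ j → Disjoint (S i) (S j)) (hcross : ∀ i, Crosses C (S i))
    (hSU : ∀ i, S i ⊆ U) (hU : (Set.univ \ (C ∪ U)).Nonempty) (t : Finset ι) :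
    (⋃ i ∈ t, S i) ∪ C ∈ F := by
  classical
  induction t using Finset.induction_on with
  | empty => simpa using hC.1
  | insert j t hj ih =>
    obtain ⟨⟨a, haC, haS⟩, ⟨b, hbC, hbS⟩, ⟨c, hcS, hcC⟩, -⟩ := hcross j
    obtain ⟨d, -, hd⟩ := hU
    have hdj : ∀ i ∈ t, ∀ x ∈ S j, x ∉ S i := fun i hi x hx hx' =>
      Set.disjoint_left.mp (hdisj i j (ne_of_mem_of_not_mem hi hj)) hx' hx
    have hinter : ((⋃ i ∈ t, S i) ∪ C) ∩ S j = C ∩ S j := by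
      ext x
      simp only [Set.mem_inter_iff, Set.mem_union, Set.mem_iUnion, exists_prop]
      refine ⟨?_, fun h => ⟨Or.inr h.1, h.2⟩⟩
      rintro ⟨⟨i, hi, hx⟩ | hx, hxj⟩
      · exact (hdj i hi x hxj hx).elim
      · exact ⟨hx, hxj⟩
    have hX : Crosses ((⋃ i ∈ t, S i) ∪ C) (S j) := by
      refine ⟨⟨a, Or.inr haC, haS⟩, ⟨b, Or.inr hbC, hbS⟩, ⟨c, hcS, ?_⟩, ⟨d, trivial, ?_⟩⟩
      · rintro (hc | hc)
        · obtain ⟨i, hi, hci⟩ := Set.mem_iUnion₂.mp hc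
          exact hdj i hi c hcS hci
        · exact hcC hc
      · rintro ((h | h) | h)
        · obtain ⟨i, -, hdi⟩ := Set.mem_iUnion₂.mp h
          exact hd (Or.inr (hSU i hdi))
        · exact hd (Or.inl h)
        · exact hd (Or.inr (hSU j h))
    have hnot : ((⋃ i ∈ t, S i) ∪ C) ∩ S j ∉ F := by
      rw [hinter]
      exact hC.2 _ ⟨Set.inter_subset_left, fun h => hbS (h hbC).2⟩
    have hmem := (hF _ ih _ (hS j) hX).1.resolve_left hnot
    rwa [Finset.set_biUnion_insert, Set.union_assoc, Set.union_comm (S j)]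

/-- a pliable family satisfying symmetry and structural
submodularity satisfies property (γ*). -/
theorem stmt7 {V : Type*} [Fintype V] (F : Set (Set V))
    (hPl : Pliable F) (hSym : SymmFamily F) (hSub : StructSubmodular F) :
    PropGammaStar F := by
  intro E k _ S₀ S C hS₀ hS hsub hdisj hC hC₀ hcross
  have hF := hSub.uncovered E
  have hU : (⋃ i, S i) ∪ C ∈ uncovered F E := by
    simpa using MinimalIn.biUnion_union_mem hC hF hS hdisj hcross
      (fun i => (hsub i).subset) hC₀.2.2.2 Finset.univ
  obtain ⟨⟨a, haC, haS⟩, ⟨b, hbC, hbS⟩, -, ⟨d, -, hd⟩⟩ := hC₀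
  have hUS : (⋃ i, S i) ⊆ S₀ := Set.iUnion_subset fun i => (hsub i).subset
  refine (Set.eq_empty_or_nonempty _).imp_right fun hT => ?_
  have hX : Crosses S₀ ((⋃ i, S i) ∪ C) :=
    ⟨⟨a, haS, Or.inr haC⟩, hT, ⟨b, Or.inr hbC, hbS⟩, ⟨d, trivial, by
      rintro (h | h | h)
      · exact hd (Or.inr h)
      · exact hd (Or.inr (hUS h))
      · exact hd (Or.inl h)⟩⟩
  refine (hF _ hS₀ _ hU hX).2.resolve_right ?_
  rw [Set.union_sdiff_distrib, Set.sdiff_eq_empty.mpr hUS, Set.empty_union]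
  exact hC.2 _ ⟨Set.sdiff_subset, fun h => (h haC).2 haS⟩
end

section
/- Let F be a pliable family of subsets of a finite ground set V that satisfies symmetry and structural submodularity, let Ê be a set of edges on V, and let L be a laminar subfamily of F_Ê. Let S0∈L and suppose C0 is the unique member of C_Ê that crosses S0. Suppose S1∈L satisfies S1⊊S0, there is no T∈L with S1⊊T⊊S0, S1 is disjoint from C0, and C1∈C_Ê crosses S1. Then C1⊆S0 and no member of L that is a proper subset of S0 contains C1 (hence the smallest member of L∪{V} containing C1 is S0). -/
/-- The complement of a set not covered by the edge set is not covered either. -/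
theorem SymmFamily.diff_mem_uncovered {V : Type*} {F : Set (Set V)} (hSym : SymmFamily F)
    {E : Set (Sym2 V)} {S : Set V} (hS : S ∈ uncovered F E) :
    Set.univ \ S ∈ uncovered F E := by
  refine ⟨(hSym S).1 hS.1, Set.eq_empty_iff_forall_notMem.2 ?_⟩
  rintro e ⟨heE, x, y, rfl, hx, hy⟩
  have hyS : y ∈ S := by simpa using hy
  exact (Set.eq_empty_iff_forall_notMem.1 hS.2) s(x, y) ⟨heE, y, x, Sym2.eq_swap, hyS, hx.2⟩

/-- Lemma on disjoint child: under the stated hypotheses,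
`C₁ ⊆ S₀` and no member of `L` properly contained in `S₀` contains `C₁`. -/
theorem stmt9 {V : Type*} [Fintype V] (F : Set (Set V)) (E : Set (Sym2 V))
    (L : Set (Set V))
    (hPl : Pliable F) (hSym : SymmFamily F) (hSub : StructSubmodular F)
    (hL : L ⊆ uncovered F E)
    (hLam : ∀ A ∈ L, ∀ B ∈ L, A ⊆ B ∨ B ⊆ A ∨ Disjoint A B)
    (S₀ : Set V) (hS₀ : S₀ ∈ L)
    (C₀ : Set V) (hC₀ : C₀ ∈ cores F E) (hC₀x : Crosses C₀ S₀)
    (hUniq : ∀ C ∈ cores F E, Crosses C S₀ → C = C₀)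
    (S₁ : Set V) (hS₁ : S₁ ∈ L) (hS₁sub : S₁ ⊂ S₀)
    (hchild : ¬ ∃ T ∈ L, S₁ ⊂ T ∧ T ⊂ S₀)
    (hdisj : Disjoint S₁ C₀)
    (C₁ : Set V) (hC₁ : C₁ ∈ cores F E) (hC₁x : Crosses C₁ S₁) :
    C₁ ⊆ S₀ ∧ ∀ T ∈ L, T ⊂ S₀ → ¬ C₁ ⊆ T := by
  obtain ⟨⟨x, hxC, hxS⟩, ⟨y, hyC, hyS⟩, ⟨z, hzS, hzC⟩, -⟩ := hC₁x
  have hxS₀ : x ∈ S₀ := hS₁sub.1 hxS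
  constructor
  · by_contra hsub
    obtain ⟨w, hwC, hwS⟩ := Set.not_subset.1 hsub
    by_cases hout : (Set.univ \ (C₁ ∪ S₀)).Nonempty
    · have hEq := hUniq C₁ hC₁ ⟨⟨x, hxC, hxS₀⟩, ⟨w, hwC, hwS⟩, ⟨z, hS₁sub.1 hzS, hzC⟩, hout⟩
      exact Set.disjoint_left.1 hdisj hxS (hEq ▸ hxC)
    · have hcompl : Set.univ \ S₀ ⊂ C₁ := by
        refine ⟨fun v hv => ?_, fun h => (h hxC).2 hxS₀⟩
        by_contra hvC
        exact hout ⟨v, trivial, fun h => h.elim hvC hv.2⟩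
      exact hC₁.2 _ hcompl (hSym.diff_mem_uncovered (hL hS₀))
  · intro T hT hTS₀ hCT
    rcases hLam T hT S₁ hS₁ with h | h | h
    · exact hyS (h (hCT hyC))
    · exact hchild ⟨T, hT, ⟨h, fun hTS₁ => hyS (hTS₁ (hCT hyC))⟩, hTS₀⟩
    · exact Set.disjoint_left.1 h (hCT hxC) hxS
end

section
/- Let F be a pliable family of subsets of a finite ground set V that satisfies symmetry and structural submodularity, let Ê be a set of edges on V, let Ĵ be an inclusion-minimal set of links covering C_Ê, and let {S_ℓ : ℓ∈Ĵ} be a laminar family of witness sets for Ĵ. Then the number of crossing pairs (S,C) with S∈{S_ℓ : ℓ∈Ĵ} and C∈C_Ê is at most 2·|C_Ê|. -/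
theorem uncovered_inter {V : Type*} {F : Set (Set V)} {E : Set (Sym2 V)} {A B : Set V}
    (hA : A ∈ uncovered F E) (hB : B ∈ uncovered F E) (h : A ∩ B ∈ F) :
    A ∩ B ∈ uncovered F E := by
  refine ⟨h, Set.eq_empty_iff_forall_notMem.2 ?_⟩
  rintro e ⟨he, x, y, rfl, hx, hy⟩
  by_cases hyA : y ∈ A
  · exact Set.eq_empty_iff_forall_notMem.1 hB.2 s(x, y)
      ⟨he, x, y, rfl, hx.2, fun hyB => hy ⟨hyA, hyB⟩⟩
  · exact Set.eq_empty_iff_forall_notMem.1 hA.2 s(x, y) ⟨he, x, y, rfl, hx.1, hyA⟩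

theorem uncovered_diff {V : Type*} {F : Set (Set V)} {E : Set (Sym2 V)} {A B : Set V}
    (hA : A ∈ uncovered F E) (hB : B ∈ uncovered F E) (h : A \ B ∈ F) :
    A \ B ∈ uncovered F E := by
  refine ⟨h, Set.eq_empty_iff_forall_notMem.2 ?_⟩
  rintro e ⟨he, x, y, rfl, hx, hy⟩
  by_cases hyA : y ∈ A
  · have hyB : y ∈ B := by_contra fun hyB => hy ⟨hyA, hyB⟩
    exact Set.eq_empty_iff_forall_notMem.1 hB.2 s(x, y)
      ⟨he, y, x, Sym2.eq_swap, hyB, hx.2⟩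
  · exact Set.eq_empty_iff_forall_notMem.1 hA.2 s(x, y) ⟨he, x, y, rfl, hx.1, hyA⟩

/-- If `S` leaves out part of a core, then what `S` cuts off from that core is not a
member of `F`. -/
theorem inter_core_notMem {V : Type*} {F : Set (Set V)} {E : Set (Sym2 V)} {S C : Set V}
    (hS : S ∈ uncovered F E) (hC : C ∈ cores F E) (h : (C \ S).Nonempty) : S ∩ C ∉ F := by
  intro hF
  obtain ⟨x, hx⟩ := h
  exact hC.2 _ ⟨Set.inter_subset_right, fun hsub => hx.2 (hsub hx.1).1⟩
    (uncovered_inter hS hC.1 hF)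

theorem core_diff_notMem {V : Type*} {F : Set (Set V)} {E : Set (Sym2 V)} {S C : Set V}
    (hS : S ∈ uncovered F E) (hC : C ∈ cores F E) (h : (S ∩ C).Nonempty) : C \ S ∉ F := by
  intro hF
  obtain ⟨x, hx⟩ := h
  exact hC.2 _ ⟨Set.sdiff_subset, fun hsub => (hsub hx.2).2 hx.1⟩
    (uncovered_diff hC.1 hS hF)

/-- Distinct cores are disjoint. -/
theorem cores_disjoint {V : Type*} {F : Set (Set V)} {E : Set (Sym2 V)} (hPl : Pliable F)
    {C D : Set V} (hC : C ∈ cores F E) (hD : D ∈ cores F E) (hne : C ≠ D) : C ∩ D = ∅ := by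
  by_contra h
  have hnon := Set.nonempty_iff_ne_empty.2 h
  have hCD : C \ D ∉ F := core_diff_notMem hD.1 hC (by rwa [Set.inter_comm])
  have hDC : D \ C ∉ F := core_diff_notMem hC.1 hD hnon
  have hsub : ¬ D ⊆ C := fun hs => hC.2 D (hs.ssubset_of_ne hne.symm) hD.1
  have hI : C ∩ D ∉ F := inter_core_notMem hC.1 hD (Set.sdiff_nonempty.2 hsub)
  have h2 := hPl.2.2 C hC.1.1 D hD.1.1
  unfold AtLeastTwo at h2
  tauto

theorem diff_mem_of_crosses_core {V : Type*} {F : Set (Set V)} {E : Set (Sym2 V)}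
    (hPl : Pliable F) {S C : Set V} (hS : S ∈ uncovered F E) (hC : C ∈ cores F E)
    (h : Crosses S C) : S \ C ∈ F := by
  have hI := inter_core_notMem hS hC h.2.2.1
  have hD := core_diff_notMem hS hC h.1
  have h2 := hPl.2.2 S hS.1 C hC.1.1
  unfold AtLeastTwo at h2
  tauto

/-- An uncovered set crosses at most one core: if `S` crossed cores `C ≠ D`, then `S \ C` and
`S \ D` would be crossing members of `F` whose differences lie properly inside `D` and `C`. -/
theorem eq_of_crosses_cores {V : Type*} {F : Set (Set V)} {E : Set (Sym2 V)}
    (hPl : Pliable F) (hSub : StructSubmodular F) {S C D : Set V} (hS : S ∈ uncovered F E)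
    (hC : C ∈ cores F E) (hD : D ∈ cores F E) (hSC : Crosses S C) (hSD : Crosses S D) :
    C = D := by
  by_contra hne
  have hdisj : ∀ x, x ∈ C → x ∉ D := fun x hx hx' =>
    Set.eq_empty_iff_forall_notMem.1 (cores_disjoint hPl hC hD hne) x ⟨hx, hx'⟩
  have hC' := diff_mem_of_crosses_core hPl hS hC hSC
  have hD' := diff_mem_of_crosses_core hPl hS hD hSD
  have hIC := inter_core_notMem hS hC hSC.2.2.1
  have hID := inter_core_notMem hS hD hSD.2.2.1
  have e1 : (S \ C) \ (S \ D) = S ∩ D := by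
    ext x; have := hdisj x; simp only [Set.mem_sdiff, Set.mem_inter_iff]; tauto
  have e2 : (S \ D) \ (S \ C) = S ∩ C := by
    ext x; have := hdisj x; simp only [Set.mem_sdiff, Set.mem_inter_iff]; tauto
  have hcr : Crosses (S \ C) (S \ D) := by
    refine ⟨?_, e1 ▸ hSD.1, e2 ▸ hSC.1, ?_⟩
    · by_contra hemp
      apply hID
      rw [Set.not_nonempty_iff_eq_empty] at hemp
      have : S \ C = S ∩ D := by rw [← e1, (Set.disjoint_iff_inter_eq_empty.2 hemp).sdiff_eq_left]
      exact this ▸ hC'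
    · obtain ⟨x, hx⟩ := hSC.2.2.2
      exact ⟨x, hx.1, fun hx' => hx.2 (Or.inl (hx'.elim (·.1) (·.1)))⟩
  have h := (hSub _ hC' _ hD' hcr).2
  rw [e1, e2] at h
  exact h.elim hID hIC

/-- An inclusion-minimal cover of a finite family has at most as many links as the family has
members. -/
theorem ncard_le_of_minimal_cover {V : Type*} {J : Set (Sym2 V)} {K : Set (Set V)}
    (hK : K.Finite) (hcover : ∀ C ∈ K, (cutLinks J C).Nonempty)
    (hmin : ∀ J' : Set (Sym2 V), J' ⊂ J → ∃ C ∈ K, cutLinks J' C = ∅) :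
    J.ncard ≤ K.ncard := by
  have hpriv : ∀ ℓ ∈ J, ∃ C ∈ K, cutLinks J C = {ℓ} := by
    intro ℓ hℓ
    obtain ⟨C, hC, hemp⟩ := hmin (J \ {ℓ}) (Set.sdiff_singleton_ssubset.2 hℓ)
    refine ⟨C, hC, (hcover C hC).subset_singleton_iff.1 fun e he => ?_⟩
    by_contra hne
    exact Set.eq_empty_iff_forall_notMem.1 hemp e ⟨⟨he.1, hne⟩, he.2⟩
  choose! c hc hcut using hpriv
  refine Set.ncard_le_ncard_of_injOn c hc (fun a ha b hb hab => ?_) hK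
  rw [← Set.singleton_eq_singleton_iff, ← hcut a ha, ← hcut b hb, hab]

/-- the number of crossing pairs `(S, C)` with `S` a witness set
and `C ∈ C_Ê` is at most `2 |C_Ê|`. -/
theorem stmt13 {V : Type*} [Fintype V] (F : Set (Set V)) (E : Set (Sym2 V))
    (J : Set (Sym2 V)) (w : Sym2 V → Set V)
    (hPl : Pliable F) (hSym : SymmFamily F) (hSub : StructSubmodular F)
    (hcover : ∀ C ∈ cores F E, (cutLinks J C).Nonempty)
    (hmin : ∀ J' : Set (Sym2 V), J' ⊂ J → ∃ C ∈ cores F E, cutLinks J' C = ∅)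
    (hwit : ∀ ℓ ∈ J, w ℓ ∈ uncovered F E ∧ cutLinks J (w ℓ) = {ℓ})
    (hlam : ∀ ℓ ∈ J, ∀ ℓ' ∈ J, w ℓ ⊆ w ℓ' ∨ w ℓ' ⊆ w ℓ ∨ Disjoint (w ℓ) (w ℓ')) :
    {p : Set V × Set V |
        (∃ ℓ ∈ J, p.1 = w ℓ) ∧ p.2 ∈ cores F E ∧ Crosses p.1 p.2}.ncard ≤
      2 * (cores F E).ncard := by
  have hle : {p : Set V × Set V | (∃ ℓ ∈ J, p.1 = w ℓ) ∧ p.2 ∈ cores F E ∧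
      Crosses p.1 p.2}.ncard ≤ (w '' J).ncard := by
    refine Set.ncard_le_ncard_of_injOn Prod.fst ?_ ?_ (Set.toFinite _)
    · rintro p ⟨⟨ℓ, hℓ, hp⟩, -⟩
      exact ⟨ℓ, hℓ, hp.symm⟩
    · rintro ⟨S, C⟩ ⟨⟨ℓ, hℓ, hp⟩, hC, hSC⟩ ⟨S', D⟩ ⟨-, hD, hSD⟩ heq
      dsimp only at hp hC hSC hD hSD heq
      subst heq
      have hS : S ∈ uncovered F E := hp ▸ (hwit ℓ hℓ).1
      rw [eq_of_crosses_cores hPl hSub hS hC hD hSC hSD]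
  have himg : (w '' J).ncard ≤ J.ncard := Set.ncard_image_le (Set.toFinite _)
  have hJ := ncard_le_of_minimal_cover (Set.toFinite (cores F E)) hcover hmin
  omega
end
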